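/- Let T = (V,E) be a tree with n ≥ 3 vertices, maximum degree Δ, f(x,y) = √(4x + 4(y−1)) − √(4x + y), V₁ = {v ∈ V' : δ(v) = 1} and V₂ = {v ∈ V' : δ(v) ≥ 2}. If Σ_{v ∈ V₁} f(l(v), 1) + Σ_{v ∈ V₂} f(l(v), 2) ≥ 0, then Σ_{v ∈ V'} √(3·l(v) + d(v)) ≤ Σ_{v ∈ V} 2·√(d(v) − 1) + 2·(√Δ − √(Δ − 1)). -/

import Mathlib

open Finset

namespace GraphEnergy

variable {V : Type*} [Fintype V] [DecidableEq V]

/-- The set of inner vertices: vertices of degree at least 2. -/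
def innerVerts (G : SimpleGraph V) [DecidableRel G.Adj] : Finset V :=
  univ.filter (fun v => 2 ≤ G.degree v)

/-- The number of neighbors of `v` that are leaves. -/
def leafCount (G : SimpleGraph V) [DecidableRel G.Adj] (v : V) : ℕ :=
  ((G.neighborFinset v).filter (fun w => G.degree w = 1)).card

/-- The number of neighbors of `v` of degree greater than 1. -/
def innerCount (G : SimpleGraph V) [DecidableRel G.Adj] (v : V) : ℕ :=
  ((G.neighborFinset v).filter (fun w => 1 < G.degree w)).card

/-- The auxiliary function `f(x,y) = √(4x + 4(y-1)) - √(4x + y)`. -/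
noncomputable def auxf (x y : ℝ) : ℝ :=
  Real.sqrt (4 * x + 4 * (y - 1)) - Real.sqrt (4 * x + y)

theorem auxf_two_le_auxf {x y : ℝ} (hx : 0 ≤ x) (hy : 2 ≤ y) : auxf x 2 ≤ auxf x y := by
  unfold auxf
  set a := Real.sqrt (4 * x + 4 * (2 - 1)) with ha
  set b := Real.sqrt (4 * x + 4 * (y - 1)) with hb
  set c := Real.sqrt (4 * x + 2) with hc
  set e := Real.sqrt (4 * x + y) with he
  have ha2 : a ^ 2 = 4 * x + 4 * (2 - 1) := Real.sq_sqrt (by linarith)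
  have hb2 : b ^ 2 = 4 * x + 4 * (y - 1) := Real.sq_sqrt (by linarith)
  have hc2 : c ^ 2 = 4 * x + 2 := Real.sq_sqrt (by linarith)
  have he2 : e ^ 2 = 4 * x + y := Real.sq_sqrt (by linarith)
  have ha0 : 0 < a := Real.sqrt_pos.2 (by linarith)
  have hb0 : 0 < b := Real.sqrt_pos.2 (by linarith)
  have hc0 : 0 < c := Real.sqrt_pos.2 (by linarith)
  have he0 : 0 < e := Real.sqrt_pos.2 (by linarith)
  have hce : c ≤ e := Real.sqrt_le_sqrt (by linarith)
  have hbe : b ≤ 4 * e := by nlinarith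
  have hac : a ≤ 4 * c := by nlinarith
  by_contra! h
  have h1 : (b - a) * (a + b) < (e - c) * (a + b) :=
    mul_lt_mul_of_pos_right (by linarith) (by linarith)
  have h2 : (e - c) * (a + b) ≤ (e - c) * (4 * e + 4 * c) :=
    mul_le_mul_of_nonneg_left (by linarith) (by linarith)
  nlinarith

theorem degree_eq_leafCount_add_innerCount (G : SimpleGraph V) [DecidableRel G.Adj] (v : V) :
    G.degree v = leafCount G v + innerCount G v := by
  unfold leafCount innerCount
  rw [← G.card_neighborFinset_eq_degree,
    ← card_filter_add_card_filter_not (s := G.neighborFinset v) (fun w => G.degree w = 1)]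
  congr 2
  refine filter_congr fun w hw => ?_
  have : 0 < G.degree w :=
    (G.degree_pos_iff_exists_adj w).2 ⟨v, ((G.mem_neighborFinset v w).1 hw).symm⟩
  omega

theorem two_mul_sqrt_degree_sub (G : SimpleGraph V) [DecidableRel G.Adj] (v : V) :
    2 * Real.sqrt ((G.degree v : ℝ) - 1) -
        Real.sqrt (3 * (leafCount G v : ℝ) + (G.degree v : ℝ)) =
      auxf (leafCount G v) (innerCount G v) := by
  have h : (G.degree v : ℝ) = leafCount G v + innerCount G v := by
    exact_mod_cast degree_eq_leafCount_add_innerCount G v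
  have h2 : (2 : ℝ) = Real.sqrt 4 := by
    rw [show (4 : ℝ) = 2 ^ 2 by norm_num, Real.sqrt_sq (by norm_num)]
  unfold auxf
  rw [h]
  nth_rewrite 1 [h2]
  rw [← Real.sqrt_mul (by norm_num)]
  congr 2 <;> ring

theorem sum_two_mul_sqrt_degree_eq_sum_innerVerts (G : SimpleGraph V) [DecidableRel G.Adj] :
    ∑ v : V, 2 * Real.sqrt ((G.degree v : ℝ) - 1) =
      ∑ v ∈ innerVerts G, 2 * Real.sqrt ((G.degree v : ℝ) - 1) := by
  symm
  refine sum_subset (subset_univ _) fun v _ hv => ?_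
  have hd : G.degree v ≤ 1 := by simp [innerVerts] at hv; omega
  have hd' : (G.degree v : ℝ) ≤ 1 := by exact_mod_cast hd
  rw [Real.sqrt_eq_zero_of_nonpos (by linarith), mul_zero]

/-- In a connected graph, a vertex with only leaf neighbors is equal or adjacent to every vertex,
i.e. the graph is a star. -/
theorem eq_or_adj_of_innerCount_eq_zero {G : SimpleGraph V} [DecidableRel G.Adj]
    (hG : G.Connected) {v : V} (hv : innerCount G v = 0) (w : V) : w = v ∨ G.Adj v w := by
  have hvw := (G.reachable_iff_reflTransGen v w).1 (hG.preconnected v w)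
  induction hvw with
  | refl => exact Or.inl rfl
  | @tail b c _ hbc ih =>
    rcases ih with rfl | ih
    · exact Or.inr hbc
    · left
      have hb : G.degree b ≤ 1 := by
        simp only [innerCount, card_eq_zero, filter_eq_empty_iff,
          SimpleGraph.mem_neighborFinset, not_lt] at hv
        exact hv ih
      rw [← G.card_neighborFinset_eq_degree, card_le_one] at hb
      exact hb c (by simpa using hbc) v (by simpa using ih.symm)

theorem innerVerts_eq_singleton {G : SimpleGraph V} [DecidableRel G.Adj]
    (hG : G.Connected) {v : V} (hd : 2 ≤ G.degree v) (hv : innerCount G v = 0) :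
    innerVerts G = {v} := by
  ext w
  simp only [innerVerts, mem_filter, mem_univ, true_and, mem_singleton]
  refine ⟨fun hw => ?_, fun hw => hw ▸ hd⟩
  refine (eq_or_adj_of_innerCount_eq_zero hG hv w).resolve_right fun hadj => ?_
  simp only [innerCount, card_eq_zero, filter_eq_empty_iff,
    SimpleGraph.mem_neighborFinset, not_lt] at hv
  have := hv hadj
  omega

theorem maxDegree_eq_of_innerVerts_eq_singleton {G : SimpleGraph V} [DecidableRel G.Adj] {v : V}
    (h : innerVerts G = {v}) : G.maxDegree = G.degree v := by
  refine le_antisymm (G.maxDegree_le_of_forall_degree_le _ fun w => ?_) (G.degree_le_maxDegree v)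
  have hv : v ∈ innerVerts G := by simp [h]
  have hw : w ∈ innerVerts G ↔ w = v := by simp [h]
  simp only [innerVerts, mem_filter, mem_univ, true_and] at hv hw
  by_cases hwv : w = v
  · rw [hwv]
  · have := mt hw.1 hwv
    omega

/-- Criterion ii): if `∑_{v ∈ V₁} f(l(v), 1) + ∑_{v ∈ V₂} f(l(v), 2) ≥ 0` for a tree on
`n ≥ 3` vertices, then the new bound improves the Arizmendi–Dominguez bound. -/
theorem tree_criterion_ii (G : SimpleGraph V) [DecidableRel G.Adj]
    (hT : G.IsTree) (hn : 3 ≤ Fintype.card V)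
    (hcond : 0 ≤
      (∑ v ∈ (innerVerts G).filter (fun v => innerCount G v = 1),
        auxf (leafCount G v : ℝ) 1) +
      ∑ v ∈ (innerVerts G).filter (fun v => 2 ≤ innerCount G v),
        auxf (leafCount G v : ℝ) 2) :
    ∑ v ∈ innerVerts G, Real.sqrt (3 * (leafCount G v : ℝ) + (G.degree v : ℝ)) ≤
      (∑ v : V, 2 * Real.sqrt ((G.degree v : ℝ) - 1)) +
        2 * (Real.sqrt (G.maxDegree : ℝ) - Real.sqrt ((G.maxDegree : ℝ) - 1)) := by
  rw [sum_two_mul_sqrt_degree_eq_sum_innerVerts]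
  by_cases hstar : ∃ v ∈ innerVerts G, innerCount G v = 0
  · obtain ⟨v, hv, hv0⟩ := hstar
    have hs := innerVerts_eq_singleton hT.connected (by simpa [innerVerts] using hv) hv0
    have h := two_mul_sqrt_degree_sub G v
    have hl : (leafCount G v : ℝ) = G.degree v := by
      rw [degree_eq_leafCount_add_innerCount G v, hv0, add_zero]
    have h4 : Real.sqrt (3 * (G.degree v : ℝ) + G.degree v) = 2 * Real.sqrt (G.degree v) := by
      rw [show 3 * (G.degree v : ℝ) + G.degree v = 2 ^ 2 * G.degree v by ring,
        Real.sqrt_mul (by norm_num), Real.sqrt_sq (by norm_num)]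
    rw [maxDegree_eq_of_innerVerts_eq_singleton hs, hs, sum_singleton, sum_singleton, hl, h4]
    linarith
  · push Not at hstar
    have hΔ : Real.sqrt ((G.maxDegree : ℝ) - 1) ≤ Real.sqrt (G.maxDegree : ℝ) :=
      Real.sqrt_le_sqrt (by linarith)
    have hsplit : (innerVerts G).filter (fun v => 2 ≤ innerCount G v) =
        (innerVerts G).filter (fun v => ¬ innerCount G v = 1) := by
      refine filter_congr fun v hv => ?_
      have := hstar v hv
      omega
    have hsum : 0 ≤ ∑ v ∈ innerVerts G, auxf (leafCount G v) (innerCount G v) := by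
      refine hcond.trans ?_
      rw [← sum_filter_add_sum_filter_not (innerVerts G) (fun v => innerCount G v = 1), ← hsplit]
      refine add_le_add (sum_le_sum fun v hv => ?_) (sum_le_sum fun v hv => ?_)
      · rw [(mem_filter.1 hv).2, Nat.cast_one]
      · exact auxf_two_le_auxf (Nat.cast_nonneg _) (by exact_mod_cast (mem_filter.1 hv).2)
    simp only [← two_mul_sqrt_degree_sub, sum_sub_distrib] at hsum
    linarith

end GraphEnergy
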